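/- There exists an infinite Boolean subalgebra A of B = P(ℕ)/Fin (the power set of ℕ modulo the ideal of finite sets) such that: (i) the Stone space K_A of A is an almost P-space; and (ii) for every pairwise disjoint family a = {a_n : n ∈ ℕ} ⊆ A \ {0} there exist a subalgebra P_a of the power set algebra P(ℕ) containing all finite sets and a submorphism φ_a : P_a → A with φ_a({n}) = a_n for all n, such that for every infinite σ ⊆ ℕ and every family {b_n : n ∈ σ} ⊆ A \ {0} of pairwise disjoint elements orthogonal to {a_n : n ∈ ℕ}, there exists τ ⊆ σ with τ ∈ P_a such that {b_n : n ∈ τ} and {b_n : n ∈ σ \ τ} are not separated in A. -/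

import Mathlib

/-- The Stone space of a Boolean algebra `A`: the space of Boolean homomorphisms `A → Bool`
(equivalently, ultrafilters on `A`), topologized as a subspace of the product `A → Bool`
with `Bool` discrete. -/
def StoneSpace (A : Type*) [BooleanAlgebra A] : Type _ :=
  {x : A → Bool // x ⊤ = true ∧ x ⊥ = false ∧
    (∀ a b : A, x (a ⊔ b) = (x a || x b)) ∧ ∀ a b : A, x (a ⊓ b) = (x a && x b)}

instance (A : Type*) [BooleanAlgebra A] : TopologicalSpace (StoneSpace A) :=
  instTopologicalSpaceSubtype

/-- Two subsets `I`, `J` of a Boolean algebra are separated if some `c` satisfies `x ≤ c`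
for all `x ∈ I` and `y ⊓ c = ⊥` for all `y ∈ J`. -/
def BASeparated {A : Type*} [BooleanAlgebra A] (I J : Set A) : Prop :=
  ∃ c : A, (∀ x ∈ I, x ≤ c) ∧ ∀ y ∈ J, y ⊓ c = ⊥

section PartOne
open Cardinal

theorem aux_card_closure {B : Type} [BooleanAlgebra B] (X : Set B) :
    #(BooleanSubalgebra.closure X) ≤ max #X ℵ₀ := by
  obtain ⟨C, hC0, hC1⟩ : ∃ C : ℕ → Set B, C 0 = insert ⊥ X ∧
      ∀ n, C (n+1) = C n ∪ (compl '' C n ∪ Set.image2 (· ⊔ ·) (C n) (C n)) :=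
    ⟨fun n => Nat.rec (insert ⊥ X)
      (fun _ S => S ∪ (compl '' S ∪ Set.image2 (· ⊔ ·) S S)) n, rfl, fun n => rfl⟩
  have hmono : Monotone C := monotone_nat_of_le_succ fun n => by
    rw [hC1]; exact Set.subset_union_left
  have hk : ℵ₀ ≤ max #X ℵ₀ := le_max_right _ _
  have hcard : ∀ n, #↥(C n) ≤ max #X ℵ₀ := by
    intro n
    induction n with
    | zero =>
      rw [hC0]
      refine (mk_insert_le).trans ?_
      exact add_le_of_le hk (le_max_left _ _) (one_le_aleph0.trans hk)
    | succ n ih =>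
      rw [hC1]
      refine (mk_union_le _ _).trans (add_le_of_le hk ih ?_)
      refine (mk_union_le _ _).trans (add_le_of_le hk (mk_image_le.trans ih) ?_)
      rw [← Set.image_prod]
      refine mk_image_le.trans ?_
      rw [mk_setProd]
      exact mul_le_of_le hk ih ih
  let L : BooleanSubalgebra B :=
    { carrier := ⋃ n, C n
      bot_mem' := Set.mem_iUnion.2 ⟨0, by rw [hC0]; exact Set.mem_insert _ _⟩
      supClosed' := by
        intro x hx y hy
        obtain ⟨n, hn⟩ := Set.mem_iUnion.1 hx
        obtain ⟨m, hm⟩ := Set.mem_iUnion.1 hy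
        refine Set.mem_iUnion.2 ⟨max n m + 1, ?_⟩
        rw [hC1]
        exact Or.inr (Or.inr ⟨x, hmono (le_max_left _ _) hn, y, hmono (le_max_right _ _) hm, rfl⟩)
      compl_mem' := by
        intro x hx
        obtain ⟨n, hn⟩ := Set.mem_iUnion.1 hx
        refine Set.mem_iUnion.2 ⟨n + 1, ?_⟩
        rw [hC1]
        exact Or.inr (Or.inl ⟨x, hn, rfl⟩)
      infClosed' := by
        intro x hx y hy
        obtain ⟨n, hn⟩ := Set.mem_iUnion.1 hx
        obtain ⟨m, hm⟩ := Set.mem_iUnion.1 hy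
        refine Set.mem_iUnion.2 ⟨max n m + 1 + 1 + 1, ?_⟩
        have : x ⊓ y = (xᶜ ⊔ yᶜ)ᶜ := by simp
        rw [this, hC1]
        refine Or.inr (Or.inl ⟨_, ?_, rfl⟩)
        rw [hC1]
        refine Or.inr (Or.inr ⟨xᶜ, ?_, yᶜ, ?_, rfl⟩)
        · rw [hC1]; exact Or.inr (Or.inl ⟨x, hmono (le_max_left _ _) hn, rfl⟩)
        · rw [hC1]; exact Or.inr (Or.inl ⟨y, hmono (le_max_right _ _) hm, rfl⟩) }
  have hle : BooleanSubalgebra.closure X ≤ L := BooleanSubalgebra.closure_le.2 fun x hx =>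
    Set.mem_iUnion.2 ⟨0, by rw [hC0]; exact Set.mem_insert_of_mem _ hx⟩
  have h1 : #(BooleanSubalgebra.closure X) ≤ #(⋃ n, C n) := mk_le_mk_of_subset hle
  refine h1.trans ?_
  refine (mk_iUnion_le C).trans ?_
  exact mul_le_of_le hk (mk_nat.le.trans hk) (ciSup_le' hcard)

/-- the element built from `u`, `v` along `x` -/
def mix {B : Type} [BooleanAlgebra B] (u v x : B) : B := (u ⊓ x) ⊔ (v ⊓ xᶜ)

theorem mix_le {B : Type} [BooleanAlgebra B] {u v x l : B} :
    l ≤ mix u v x ↔ l ⊓ x ≤ u ∧ l ⊓ xᶜ ≤ v := by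
  unfold mix
  constructor
  · intro h
    constructor
    · calc l ⊓ x ≤ (u ⊓ x ⊔ v ⊓ xᶜ) ⊓ x := inf_le_inf_right _ h
        _ = u ⊓ x := by
          rw [inf_sup_right, inf_assoc, inf_assoc]; simp
        _ ≤ u := inf_le_left
    · calc l ⊓ xᶜ ≤ (u ⊓ x ⊔ v ⊓ xᶜ) ⊓ xᶜ := inf_le_inf_right _ h
        _ = v ⊓ xᶜ := by
          rw [inf_sup_right, inf_assoc, inf_assoc]; simp
        _ ≤ v := inf_le_left
  · rintro ⟨h1, h2⟩
    calc l = (l ⊓ x) ⊔ (l ⊓ xᶜ) := by rw [← inf_sup_left]; simp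
      _ ≤ _ := sup_le_sup (le_inf h1 inf_le_right) (le_inf h2 inf_le_right)

theorem inf_mix {B : Type} [BooleanAlgebra B] {u v x r : B} :
    r ⊓ mix u v x = ⊥ ↔ r ⊓ x ⊓ u = ⊥ ∧ r ⊓ xᶜ ⊓ v = ⊥ := by
  unfold mix
  rw [inf_sup_left, sup_eq_bot_iff, inf_assoc, inf_assoc, inf_comm x, inf_comm xᶜ]

theorem mix_compl {B : Type} [BooleanAlgebra B] (u v x : B) : (mix u v x)ᶜ = mix uᶜ vᶜ x := by
  apply le_antisymm
  · rw [mix_le]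
    constructor
    · rw [le_compl_iff_disjoint_right, disjoint_iff, inf_assoc]
      have : x ⊓ u ≤ mix u v x := by unfold mix; rw [inf_comm]; exact le_sup_left
      exact le_bot_iff.1 ((inf_le_inf_left _ this).trans (by simp))
    · rw [le_compl_iff_disjoint_right, disjoint_iff, inf_assoc]
      have : xᶜ ⊓ v ≤ mix u v x := by unfold mix; rw [inf_comm]; exact le_sup_right
      exact le_bot_iff.1 ((inf_le_inf_left _ this).trans (by simp))
  · rw [le_compl_iff_disjoint_right, disjoint_iff, inf_mix]
    unfold mix
    constructor
    · rw [inf_sup_right, inf_sup_right]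
      have e1 : uᶜ ⊓ x ⊓ x ⊓ u = ⊥ := le_bot_iff.1 (by
        calc uᶜ ⊓ x ⊓ x ⊓ u ≤ uᶜ ⊓ u := inf_le_inf_right _ (inf_le_left.trans inf_le_left)
          _ ≤ ⊥ := by simp)
      have e2 : vᶜ ⊓ xᶜ ⊓ x ⊓ u = ⊥ := by rw [inf_assoc vᶜ]; simp
      rw [e1, e2]; simp
    · rw [inf_sup_right, inf_sup_right]
      have e1 : vᶜ ⊓ xᶜ ⊓ xᶜ ⊓ v = ⊥ := le_bot_iff.1 (by
        calc vᶜ ⊓ xᶜ ⊓ xᶜ ⊓ v ≤ vᶜ ⊓ v := inf_le_inf_right _ (inf_le_left.trans inf_le_left)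
          _ ≤ ⊥ := by simp)
      have e2 : uᶜ ⊓ x ⊓ xᶜ ⊓ v = ⊥ := by rw [inf_assoc uᶜ]; simp
      rw [e1, e2]; simp

theorem mix_sup {B : Type} [BooleanAlgebra B] (u v u' v' x : B) :
    mix u v x ⊔ mix u' v' x = mix (u ⊔ u') (v ⊔ v') x := by
  unfold mix
  rw [inf_sup_right, inf_sup_right]
  exact sup_sup_sup_comm _ _ _ _

theorem mem_closure_insert_mix {B : Type} [BooleanAlgebra B] (X : Set B) (x c : B)
    (hc : c ∈ BooleanSubalgebra.closure (insert x X)) :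
    ∃ u ∈ BooleanSubalgebra.closure X, ∃ v ∈ BooleanSubalgebra.closure X, c = mix u v x := by
  induction hc using BooleanSubalgebra.closure_bot_sup_induction with
  | mem y hy =>
    rcases hy with rfl | hy
    · exact ⟨⊤, BooleanSubalgebra.top_mem, ⊥, BooleanSubalgebra.bot_mem, by simp [mix]⟩
    · exact ⟨y, BooleanSubalgebra.subset_closure hy, y, BooleanSubalgebra.subset_closure hy, by
        unfold mix; rw [← inf_sup_left]; simp⟩
  | bot => exact ⟨⊥, BooleanSubalgebra.bot_mem, ⊥, BooleanSubalgebra.bot_mem, by simp [mix]⟩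
  | sup y hy z hz ihy ihz =>
    obtain ⟨u, hu, v, hv, rfl⟩ := ihy
    obtain ⟨u', hu', v', hv', rfl⟩ := ihz
    exact ⟨_, BooleanSubalgebra.sup_mem hu hu', _, BooleanSubalgebra.sup_mem hv hv', mix_sup _ _ _ _ _⟩
  | compl y hy ihy =>
    obtain ⟨u, hu, v, hv, rfl⟩ := ihy
    exact ⟨_, BooleanSubalgebra.compl_mem hu, _, BooleanSubalgebra.compl_mem hv, mix_compl _ _ _⟩

theorem mem_closure_finite {B : Type} [BooleanAlgebra B] (X : Set B) (c : B)
    (hc : c ∈ BooleanSubalgebra.closure X) :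
    ∃ F : Set B, F ⊆ X ∧ F.Finite ∧ c ∈ BooleanSubalgebra.closure F := by
  induction hc using BooleanSubalgebra.closure_bot_sup_induction with
  | mem y hy => exact ⟨{y}, by simpa using hy, Set.finite_singleton _,
      BooleanSubalgebra.subset_closure rfl⟩
  | bot => exact ⟨∅, by simp, Set.finite_empty, BooleanSubalgebra.bot_mem⟩
  | sup y hy z hz ihy ihz =>
    obtain ⟨F, h1, h2, h3⟩ := ihy
    obtain ⟨F', h1', h2', h3'⟩ := ihz
    exact ⟨F ∪ F', Set.union_subset h1 h1', h2.union h2', BooleanSubalgebra.sup_mem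
      (BooleanSubalgebra.closure_mono Set.subset_union_left h3)
      (BooleanSubalgebra.closure_mono Set.subset_union_right h3')⟩
  | compl y hy ihy =>
    obtain ⟨F, h1, h2, h3⟩ := ihy
    exact ⟨F, h1, h2, BooleanSubalgebra.compl_mem h3⟩

/-- `c` separates the pair `p`. -/
def SepBy {B : Type} [BooleanAlgebra B] (p : Set B × Set B) (c : B) : Prop :=
  (∀ x ∈ p.1, x ≤ c) ∧ ∀ y ∈ p.2, y ⊓ c = ⊥

theorem sepBy_two {B : Type} [BooleanAlgebra B] (p : Set B × Set B) (u v x x' : B)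
    (h1 : SepBy p (mix u v x)) (h2 : SepBy p (mix u v x')) : SepBy p (mix u v (x ⊓ x')) := by
  constructor
  · intro l hl
    have a1 := mix_le.1 (h1.1 l hl)
    have a2 := mix_le.1 (h2.1 l hl)
    rw [mix_le]
    constructor
    · exact (inf_le_inf_left _ inf_le_left).trans a1.1
    · rw [compl_inf, inf_sup_left]
      exact sup_le a1.2 a2.2
  · intro r hr
    have a1 := inf_mix.1 (h1.2 r hr)
    have a2 := inf_mix.1 (h2.2 r hr)
    rw [inf_mix]
    constructor
    · exact le_bot_iff.1 ((inf_le_inf_right _ (inf_le_inf_left _ inf_le_left)).trans a1.1.le)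
    · rw [compl_inf, inf_sup_left, inf_sup_right, a1.2, a2.2]; simp

/-- if `β` is in `p`'s left for `x` and right for `x'` then it is covered. -/
theorem le_sup_of_mix {B : Type} [BooleanAlgebra B] {u v x x' β : B}
    (h1 : β ≤ mix u v x) (h2 : β ⊓ mix u v x' = ⊥) : β ≤ x ⊔ x' := by
  have a1 := (mix_le.1 h1).2
  have a2 := (inf_mix.1 h2).2
  have : β ⊓ (x ⊔ x')ᶜ = ⊥ := by
    rw [compl_sup]
    apply le_bot_iff.1
    rw [← a2]
    refine le_inf (inf_le_inf_left _ inf_le_right) ((inf_le_inf_left _ inf_le_left).trans a1)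
  exact disjoint_compl_right_iff.1 (disjoint_iff.2 this)

theorem mk_iUnion_countable_lt {ι E : Type} (hι : #ι < continuum)
    (S : ι → Set E) (hS : ∀ i, (S i).Countable) : #↥(⋃ i, S i) < continuum := by
  have h1 : #(⋃ i, S i) ≤ #ι * ℵ₀ := (mk_iUnion_le S).trans
    (mul_le_mul_right (ciSup_le' fun i => (le_aleph0_iff_set_countable.2 (hS i))) _)
  exact h1.trans_lt (mul_lt_of_lt aleph0_le_continuum hι aleph0_lt_continuum)

theorem exists_not_mem_of_countable {ι : Type} (hι : #ι < continuum)
    (S : ι → Set (ℕ → Bool)) (hS : ∀ i, (S i).Countable) : ∃ ξ, ∀ i, ξ ∉ S i := by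
  by_contra hcon
  push Not at hcon
  have hun : (⋃ i, S i) = Set.univ := Set.eq_univ_of_forall fun ξ => Set.mem_iUnion.2 (hcon ξ)
  have h1 : #(⋃ i, S i) ≤ #ι * ℵ₀ := (mk_iUnion_le S).trans
    (mul_le_mul_right (ciSup_le' fun i => (le_aleph0_iff_set_countable.2 (hS i))) _)
  rw [hun, mk_univ] at h1
  have h2 : #(ℕ → Bool) = continuum := by simp
  rw [h2] at h1
  exact absurd h1 (not_le.2 (mul_lt_of_lt aleph0_le_continuum hι aleph0_lt_continuum))

theorem exists_ad_family : ∃ T : (ℕ → Bool) → Set ℕ, (∀ ξ, (T ξ).Infinite) ∧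
    ∀ ξ η, ξ ≠ η → (T ξ ∩ T η).Finite := by
  refine ⟨fun ξ => Set.range fun n => Encodable.encode ((List.range n).map ξ), ?_, ?_⟩
  · intro ξ
    apply Set.infinite_range_of_injective
    intro n m hnm
    have := congrArg List.length (Encodable.encode_injective hnm)
    simpa using this
  · intro ξ η hne
    obtain ⟨k, hk⟩ := Function.ne_iff.1 hne
    apply ((Set.finite_le_nat k).image fun n => Encodable.encode ((List.range n).map ξ)).subset
    rintro _ ⟨⟨n, rfl⟩, ⟨m, hm⟩⟩
    refine ⟨n, ?_, rfl⟩
    have h1 := Encodable.encode_injective hm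
    have h2 := congrArg List.length h1
    simp only [List.length_map, List.length_range] at h2
    subst h2
    by_contra hlt
    simp only [Set.mem_ofPred_eq, not_le] at hlt
    rw [List.map_inj_left] at h1
    exact hk (h1 k (List.mem_range.2 hlt)).symm

theorem transfinite_build {E T : Type} (hT : #T ≤ continuum) (Good : Set E → Prop)
    (Done : T → Set E → Prop)
    (hfin : ∀ Z, (∀ F ⊆ Z, F.Finite → ∃ Z', F ⊆ Z' ∧ Good Z') → Good Z)
    (hmono : ∀ t Z Z', Z ⊆ Z' → Done t Z → Done t Z')
    (Z0 : Set E) (hZ0 : Good Z0) (hZ0c : Z0.Countable)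
    (step : ∀ (t : T) (Z : Set E), #↥Z < continuum → Good Z →
      ∃ Y : Set E, Y.Countable ∧ Good (Z ∪ Y) ∧ Done t (Z ∪ Y)) :
    ∃ Z, Z0 ⊆ Z ∧ Good Z ∧ ∀ t, Done t Z := by
  classical
  obtain ⟨r, wo, hr⟩ := Cardinal.exists_ord_eq T
  have hseg : ∀ t : T, #{s // r s t} < continuum := fun t => by
    refine lt_of_lt_of_le ?_ hT
    exact Cardinal.card_typein_lt t hr
  have wf : WellFounded r := wo.wf
  obtain ⟨D, hD⟩ : ∃ D : T → Set E, ∀ t, D t =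
      if h : ∃ Y : Set E, Y.Countable ∧ Good ((Z0 ∪ ⋃ s : {s // r s t}, D s.1) ∪ Y) ∧
        Done t ((Z0 ∪ ⋃ s : {s // r s t}, D s.1) ∪ Y) then h.choose else ∅ := by
    refine ⟨wf.fix fun t D =>
      if h : ∃ Y : Set E, Y.Countable ∧ Good ((Z0 ∪ ⋃ s : {s // r s t}, D s.1 s.2) ∪ Y) ∧
        Done t ((Z0 ∪ ⋃ s : {s // r s t}, D s.1 s.2) ∪ Y) then h.choose else ∅, fun t => ?_⟩
    rw [WellFounded.fix_eq]
  obtain ⟨ZZ, hZZ⟩ : ∃ ZZ : T → Set E, ∀ t, ZZ t = Z0 ∪ ⋃ s : {s // r s t}, D s.1 := ⟨_, fun _ => rfl⟩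
  simp only [← hZZ] at hD
  have hZ0Z : ∀ t, Z0 ⊆ ZZ t := fun t => by rw [hZZ]; exact Set.subset_union_left
  have hDZ : ∀ s t, r s t → D s ⊆ ZZ t := fun s t hst => by
    rw [hZZ]
    refine Set.subset_union_of_subset_right ?_ _
    exact Set.subset_iUnion (fun s : {s // r s t} => D s.1) ⟨s, hst⟩
  have hDc : ∀ t, (D t).Countable := fun t => by
    rw [hD]
    split_ifs with h
    · exact h.choose_spec.1
    · exact Set.countable_empty
  have hZc : ∀ t, #↥(ZZ t) < continuum := fun t => by
    rw [hZZ]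
    refine (mk_union_le _ _).trans_lt (add_lt_of_lt aleph0_le_continuum
      ((le_aleph0_iff_set_countable.2 hZ0c).trans_lt aleph0_lt_continuum) ?_)
    exact mk_iUnion_countable_lt (hseg t) _ (fun i => hDc i.1)
  have hV : ∀ s t, r s t → ZZ s ∪ D s ⊆ ZZ t := by
    intro s t hst
    refine Set.union_subset ?_ (hDZ s t hst)
    rw [hZZ s]
    exact Set.union_subset (hZ0Z t) (Set.iUnion_subset fun q => hDZ _ _ (_root_.trans q.2 hst))
  -- finite subsets
  have hlim : ∀ S : Set T, (∀ s ∈ S, Good (ZZ s ∪ D s)) → Good (Z0 ∪ ⋃ s ∈ S, D s) := by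
    intro S hS
    apply hfin
    intro F hF hFf
    have key : (F ⊆ Z0) ∨ ∃ s ∈ S, F ⊆ ZZ s ∪ D s := by
      induction F, hFf using Set.Finite.induction_on with
      | empty => left; simp
      | @insert e F he hFf ih =>
        have ih := ih ((Set.subset_insert _ _).trans hF)
        have h1 := hF (Set.mem_insert e F)
        have h2 : e ∈ Z0 ∨ ∃ s ∈ S, e ∈ ZZ s ∪ D s := by
          rcases h1 with h1 | h1
          · exact Or.inl h1
          · simp only [Set.mem_iUnion] at h1
            obtain ⟨s, hs, h1⟩ := h1
            exact Or.inr ⟨s, hs, Or.inr h1⟩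
        have hz : ∀ s, Z0 ⊆ ZZ s ∪ D s := fun s =>
          (hZ0Z s).trans Set.subset_union_left
        rcases ih with ih | ⟨s, hs, ih⟩ <;> rcases h2 with h2 | ⟨s', hs', h2⟩
        · exact Or.inl (Set.insert_subset h2 ih)
        · exact Or.inr ⟨s', hs', Set.insert_subset h2 (ih.trans (hz _))⟩
        · exact Or.inr ⟨s, hs, Set.insert_subset (hz _ h2) ih⟩
        · rcases trichotomous_of r s s' with h | h | h
          · exact Or.inr ⟨s', hs', Set.insert_subset h2
              (ih.trans ((hV _ _ h).trans Set.subset_union_left))⟩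
          · subst h
            exact Or.inr ⟨s, hs, Set.insert_subset h2 ih⟩
          · exact Or.inr ⟨s, hs, Set.insert_subset ((hV _ _ h).trans Set.subset_union_left h2) ih⟩
    rcases key with h | ⟨s, hs, h⟩
    · exact ⟨Z0, h, hZ0⟩
    · exact ⟨_, h, hS s hs⟩
  have main : ∀ t, Good (ZZ t ∪ D t) ∧ Done t (ZZ t ∪ D t) := by
    intro t
    induction t using wf.induction with
    | _ t ih =>
      have hg : Good (ZZ t) := by
        have := hlim {s | r s t} (fun s hs => (ih s hs).1)
        have e : ZZ t = Z0 ∪ ⋃ s ∈ {s | r s t}, D s := by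
          simp only [hZZ, Set.iUnion_subtype, Set.mem_ofPred_eq]
        rw [e]; exact this
      have hex := step t (ZZ t) (hZc t) hg
      have hDt : D t = hex.choose := by rw [hD, dif_pos hex]
      rw [hDt]
      exact hex.choose_spec.2
  refine ⟨Z0 ∪ ⋃ s ∈ (Set.univ : Set T), D s, Set.subset_union_left,
    hlim Set.univ (fun s _ => (main s).1), fun t => ?_⟩
  refine hmono t _ _ ?_ (main t).2
  refine Set.union_subset ?_ ?_
  · rw [hZZ]
    refine Set.union_subset_union_right _ ?_
    refine Set.iUnion_subset fun q => ?_
    exact Set.subset_biUnion_of_mem (u := D) (Set.mem_univ q.1)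
  · refine Set.subset_union_of_subset_right ?_ _
    exact Set.subset_biUnion_of_mem (u := D) (Set.mem_univ t)

end PartOne

section PartTwo
open Cardinal

/-- `h` presents `B` as the quotient of the power set of the naturals by the finite sets. -/
structure PFH {B : Type} [BooleanAlgebra B] (h : Set ℕ → B) : Prop where
  hbot : h ∅ = ⊥
  htop : h Set.univ = ⊤
  hsup : ∀ s t : Set ℕ, h (s ∪ t) = h s ⊔ h t
  hinf : ∀ s t : Set ℕ, h (s ∩ t) = h s ⊓ h t
  hcompl : ∀ s : Set ℕ, h sᶜ = (h s)ᶜ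
  hsurj : Function.Surjective h
  hker : ∀ s : Set ℕ, h s = ⊥ ↔ s.Finite

theorem PFH.le_iff {B : Type} [BooleanAlgebra B] {h : Set ℕ → B} (H : PFH h) (s t : Set ℕ) :
    h s ≤ h t ↔ (s \ t).Finite := by
  rw [← H.hker, Set.sdiff_eq, H.hinf, H.hcompl, ← disjoint_iff, disjoint_compl_right_iff]

theorem PFH.exists_part {B : Type} [BooleanAlgebra B] {h : Set ℕ → B} (H : PFH h) (a : ℕ → B)
    (ha : ∀ n m, n ≠ m → a n ⊓ a m = ⊥) : ∃ p : ℕ → ℕ, ∀ n, h (p ⁻¹' {n}) = a n := by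
  classical
  choose R hR using fun n => H.hsurj (a n)
  have hRR : ∀ n m, n ≠ m → (R n ∩ R m).Finite := fun n m hnm => by
    rw [← H.hker, H.hinf, hR, hR, ha n m hnm]
  let p : ℕ → ℕ := fun k => if hk : ∃ n, n ≤ k ∧ k ∈ R n then Nat.find hk else k
  have hp1 : ∀ k, (∃ n, n ≤ k ∧ k ∈ R n) → k ∈ R (p k) := fun k hk => by
    simp only [p, dif_pos hk]; exact (Nat.find_spec hk).2
  have hp2 : ∀ k, ¬ (∃ n, n ≤ k ∧ k ∈ R n) → p k = k := fun k hk => by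
    simp only [p, dif_neg hk]
  have hp3 : ∀ k n, n ≤ k → k ∈ R n → p k ≤ n := fun k n h1 h2 => by
    have hk : ∃ n, n ≤ k ∧ k ∈ R n := ⟨n, h1, h2⟩
    simp only [p, dif_pos hk]; exact Nat.find_le ⟨h1, h2⟩
  refine ⟨p, fun n => ?_⟩
  rw [← hR n]
  apply le_antisymm
  · rw [H.le_iff]
    apply (Set.finite_singleton n).subset
    rintro k ⟨hk1, hk2⟩
    have hk1 : p k = n := hk1
    by_cases hk : ∃ n, n ≤ k ∧ k ∈ R n
    · exact absurd (hk1 ▸ hp1 k hk) hk2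
    · exact (hp2 k hk).symm.trans hk1
  · rw [H.le_iff]
    have : (Set.Iio n ∪ ⋃ m ∈ Set.Iio n, (R n ∩ R m)).Finite :=
      (Set.finite_Iio n).union ((Set.finite_Iio n).biUnion fun m hm => hRR n m (ne_of_gt hm))
    apply this.subset
    rintro k ⟨hk1, hk2⟩
    have hk2 : p k ≠ n := hk2
    by_cases hkn : k < n
    · exact Or.inl hkn
    · right
      have hk : ∃ n, n ≤ k ∧ k ∈ R n := ⟨n, not_lt.1 hkn, hk1⟩
      have hlt : p k < n := lt_of_le_of_ne (hp3 k n (not_lt.1 hkn) hk1) hk2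
      simp only [Set.mem_iUnion]
      exact ⟨p k, hlt, hk1, hp1 k hk⟩

theorem PFH.fin_mem {B : Type} [BooleanAlgebra B] {h : Set ℕ → B} (H : PFH h) {a : ℕ → B}
    {p : ℕ → ℕ} (hp : ∀ n, h (p ⁻¹' {n}) = a n) (L : BooleanSubalgebra B) (hL : ∀ n, a n ∈ L)
    (F : Set ℕ) (hF : F.Finite) : h (p ⁻¹' F) ∈ L := by
  induction F, hF using Set.Finite.induction_on with
  | empty => rw [Set.preimage_empty, H.hbot]; exact BooleanSubalgebra.bot_mem
  | @insert e F he hF ih =>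
    rw [Set.insert_eq, Set.preimage_union, H.hsup, hp]
    exact BooleanSubalgebra.sup_mem (hL _) ih

theorem PFH.fin_orth {B : Type} [BooleanAlgebra B] {h : Set ℕ → B} (H : PFH h) {a : ℕ → B}
    {p : ℕ → ℕ} (hp : ∀ n, h (p ⁻¹' {n}) = a n) (β : B) (hL : ∀ n, β ⊓ a n = ⊥)
    (F : Set ℕ) (hF : F.Finite) : β ⊓ h (p ⁻¹' F) = ⊥ := by
  induction F, hF using Set.Finite.induction_on with
  | empty => rw [Set.preimage_empty, H.hbot]; simp
  | @insert e F he hF ih =>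
    rw [Set.insert_eq, Set.preimage_union, H.hsup, hp, inf_sup_left, hL, ih]; simp

/-- generators -/
def gens {B : Type} (Z : Set (B ⊕ (Set B × Set B))) : Set B := {x | Sum.inl x ∈ Z}

/-- no promise of `Z` is broken by the algebra generated by `Z` -/
def GoodZ {B : Type} [BooleanAlgebra B] (Z : Set (B ⊕ (Set B × Set B))) : Prop :=
  ∀ p, Sum.inr p ∈ Z → ∀ c ∈ BooleanSubalgebra.closure (gens Z), ¬ SepBy p c

theorem GoodZ.anti {B : Type} [BooleanAlgebra B] {Z Z' : Set (B ⊕ (Set B × Set B))}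
    (hZ : Z ⊆ Z') (hg : GoodZ Z') : GoodZ Z := fun p hp c hc =>
  hg p (hZ hp) c (BooleanSubalgebra.closure_mono
    (show gens Z ⊆ gens Z' from fun _ hx => hZ hx) hc)

theorem GoodZ.fin {B : Type} [BooleanAlgebra B] (Z : Set (B ⊕ (Set B × Set B)))
    (hF : ∀ F ⊆ Z, F.Finite → ∃ Z', F ⊆ Z' ∧ GoodZ Z') : GoodZ Z := by
  intro p hp c hc
  obtain ⟨F, h1, h2, h3⟩ := mem_closure_finite _ _ hc
  obtain ⟨Z', h4, h5⟩ := hF (insert (Sum.inr p) (Sum.inl '' F)) (by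
    apply Set.insert_subset hp
    rintro _ ⟨x, hx, rfl⟩
    exact h1 hx) ((h2.image _).insert _)
  refine h5 p (h4 (Set.mem_insert _ _)) c (BooleanSubalgebra.closure_mono ?_ h3)
  intro x hx
  exact h4 (Or.inr ⟨x, hx, rfl⟩)

theorem step_core {B : Type} [BooleanAlgebra B] (Z : Set (B ⊕ (Set B × Set B)))
    (hZ : #↥Z < continuum) (hg : GoodZ Z) (x : (ℕ → Bool) → B)
    (hx : ∀ ξ η, ξ ≠ η → x ξ ⊓ x η ∈ BooleanSubalgebra.closure (gens Z))
    (Q : (ℕ → Bool) → Set (Set B × Set B))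
    (hQ : ∀ u v, {ξ | ∃ p ∈ Q ξ, SepBy p (mix u v (x ξ))}.Countable) :
    ∃ ξ, GoodZ (Z ∪ insert (Sum.inl (x ξ)) (Sum.inr '' Q ξ)) := by
  let A := BooleanSubalgebra.closure (gens Z)
  have hgens : #(gens Z) ≤ #↥Z := by
    refine mk_le_of_injective (f := fun x : gens Z => (⟨Sum.inl x.1, x.2⟩ : Z)) ?_
    intro x y hxy
    simpa [Subtype.ext_iff] using hxy
  have hprom : #{p : Set B × Set B // Sum.inr p ∈ Z} ≤ #↥Z := by
    refine mk_le_of_injective (f := fun x => (⟨Sum.inr x.1, x.2⟩ : Z)) ?_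
    intro x y hxy
    simpa [Subtype.ext_iff] using hxy
  have hA : #A < continuum := (aux_card_closure _).trans_lt
    (max_lt (hgens.trans_lt hZ) aleph0_lt_continuum)
  have hAA : #(A × A) < continuum := by
    rw [mk_prod, lift_id]; exact mul_lt_of_lt aleph0_le_continuum hA hA
  have hι : #(({p : Set B × Set B // Sum.inr p ∈ Z} × (A × A)) ⊕ (A × A)) < continuum := by
    rw [mk_sum, lift_id, lift_id]
    refine add_lt_of_lt aleph0_le_continuum ?_ hAA
    rw [mk_prod, lift_id, lift_id]
    exact mul_lt_of_lt aleph0_le_continuum (hprom.trans_lt hZ) hAA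
  obtain ⟨ξ, hξ⟩ := exists_not_mem_of_countable hι
    (Sum.elim (fun i => {ξ | SepBy i.1.1 (mix i.2.1.1 i.2.2.1 (x ξ))})
      (fun i => {ξ | ∃ p ∈ Q ξ, SepBy p (mix i.1.1 i.2.1 (x ξ))})) (by
    rintro (⟨p, u, v⟩ | ⟨u, v⟩)
    · apply Set.Subsingleton.countable
      intro ξ hξ η hη
      by_contra hne
      have := sepBy_two _ _ _ _ _ hξ hη
      refine hg p.1 p.2 _ ?_ this
      unfold mix
      exact BooleanSubalgebra.sup_mem (BooleanSubalgebra.inf_mem u.2 (hx _ _ hne))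
        (BooleanSubalgebra.inf_mem v.2 (BooleanSubalgebra.compl_mem (hx _ _ hne)))
    · exact hQ u.1 v.1)
  refine ⟨ξ, ?_⟩
  have hge : gens (Z ∪ insert (Sum.inl (x ξ)) (Sum.inr '' Q ξ)) ⊆ insert (x ξ) (gens Z) := by
    rintro y (hy | hy | ⟨q, hq, hy⟩)
    · exact Or.inr hy
    · exact Or.inl (Sum.inl_injective hy)
    · cases hy
  intro p hp c hc hs
  obtain ⟨u, hu, v, hv, rfl⟩ := mem_closure_insert_mix _ _ _ (BooleanSubalgebra.closure_mono hge hc)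
  rcases hp with hp | hp | ⟨q, hq, hp⟩
  · exact hξ (Sum.inl (⟨p, hp⟩, ⟨u, hu⟩, ⟨v, hv⟩)) hs
  · cases hp
  · have : q = p := Sum.inr_injective hp
    subst this
    exact hξ (Sum.inr (⟨u, hu⟩, ⟨v, hv⟩)) ⟨q, hq, hs⟩

/-- the pair of families given by `b` on `τ` and on `σ \ τ` -/
def prom {B : Type} (b : ℕ → B) (σ τ : Set ℕ) : Set B × Set B :=
  ({x | ∃ n ∈ τ, x = b n}, {x | ∃ n ∈ σ \ τ, x = b n})

/-- being done with a task -/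
def DoneT {B : Type} [BooleanAlgebra B] (h : Set ℕ → B) (pa : (ℕ → B) → ℕ → ℕ)
    (t : ((ℕ → B) × Set ℕ × (ℕ → B)) ⊕ (ℕ → B)) (Z : Set (B ⊕ (Set B × Set B))) : Prop :=
  match t with
  | Sum.inl (a, σ, b) =>
    (∀ n m, n ≠ m → a n ⊓ a m = ⊥) → σ.Infinite → (∀ n ∈ σ, b n ≠ ⊥) →
    (∀ n ∈ σ, ∀ m, b n ⊓ a m = ⊥) →
    (¬ GoodZ (Z ∪ Sum.inl '' Set.range a)) ∨
    ∃ τ ⊆ σ, Sum.inl (h (pa a ⁻¹' τ)) ∈ Z ∧ Sum.inr (prom b σ τ) ∈ Z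
  | Sum.inr d => (∀ n, d n ≠ ⊥) → Antitone d → ∃ w, w ≠ ⊥ ∧ Sum.inl w ∈ Z ∧ ∀ n, w ≤ d n

theorem DoneT.mono {B : Type} [BooleanAlgebra B] (h : Set ℕ → B) (pa : (ℕ → B) → ℕ → ℕ)
    (t : ((ℕ → B) × Set ℕ × (ℕ → B)) ⊕ (ℕ → B)) (Z Z' : Set (B ⊕ (Set B × Set B)))
    (hZ : Z ⊆ Z') (hd : DoneT h pa t Z) : DoneT h pa t Z' := by
  rcases t with ⟨a, σ, b⟩ | d
  · intro h1 h2 h3 h4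
    rcases hd h1 h2 h3 h4 with h5 | ⟨τ, h5, h6, h7⟩
    · exact Or.inl fun hg => h5 (hg.anti (Set.union_subset_union_left _ hZ))
    · exact Or.inr ⟨τ, h5, hZ h6, hZ h7⟩
  · intro h1 h2
    obtain ⟨w, h3, h4, h5⟩ := hd h1 h2
    exact ⟨w, h3, hZ h4, h5⟩

theorem stepOne {B : Type} [BooleanAlgebra B] {h : Set ℕ → B} (H : PFH h)
    (pa : (ℕ → B) → ℕ → ℕ)
    (hpa : ∀ a : ℕ → B, (∀ n m, n ≠ m → a n ⊓ a m = ⊥) → ∀ n, h (pa a ⁻¹' {n}) = a n)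
    (a : ℕ → B) (σ : Set ℕ) (b : ℕ → B) (Z : Set (B ⊕ (Set B × Set B)))
    (hZ : #↥Z < continuum) (hg : GoodZ Z) :
    ∃ Y : Set (B ⊕ (Set B × Set B)), Y.Countable ∧ GoodZ (Z ∪ Y) ∧
      DoneT h pa (Sum.inl (a, σ, b)) (Z ∪ Y) := by
  by_cases hv : (∀ n m, n ≠ m → a n ⊓ a m = ⊥) ∧ σ.Infinite ∧ (∀ n ∈ σ, b n ≠ ⊥) ∧
    (∀ n ∈ σ, ∀ m, b n ⊓ a m = ⊥)
  swap
  · exact ⟨∅, Set.countable_empty, by simpa using hg,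
      fun h1 h2 h3 h4 => absurd ⟨h1, h2, h3, h4⟩ hv⟩
  obtain ⟨h1, h2, h3, h4⟩ := hv
  by_cases hg1 : GoodZ (Z ∪ Sum.inl '' Set.range a)
  swap
  · refine ⟨∅, Set.countable_empty, by simpa using hg, fun _ _ _ _ => Or.inl ?_⟩
    simpa using hg1
  set Z1 := Z ∪ Sum.inl '' Set.range a with hZ1
  have hcr : (Sum.inl '' Set.range a : Set (B ⊕ (Set B × Set B))).Countable :=
    (Set.countable_range a).image _
  have hZ1c : #↥Z1 < continuum :=
    (mk_union_le _ _).trans_lt (add_lt_of_lt aleph0_le_continuum hZ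
      ((le_aleph0_iff_set_countable.2 hcr).trans_lt aleph0_lt_continuum))
  have ham : ∀ n, a n ∈ BooleanSubalgebra.closure (gens Z1) := fun n =>
    BooleanSubalgebra.subset_closure (Or.inr ⟨a n, ⟨n, rfl⟩, rfl⟩)
  obtain ⟨T, hT1, hT2⟩ := exists_ad_family
  obtain ⟨g, hginj, hgσ⟩ : ∃ g : ℕ → ℕ, Function.Injective g ∧ ∀ n, g n ∈ σ :=
    ⟨Nat.nth (· ∈ σ), Nat.nth_injective h2, fun n => Nat.nth_mem_of_infinite h2 n⟩
  let τ : (ℕ → Bool) → Set ℕ := fun ξ => g '' T ξ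
  have hτσ : ∀ ξ, τ ξ ⊆ σ := by
    rintro ξ _ ⟨n, _, rfl⟩; exact hgσ n
  have hτi : ∀ ξ, (τ ξ).Infinite := fun ξ => (hT1 ξ).image hginj.injOn
  have hτf : ∀ ξ η, ξ ≠ η → (τ ξ ∩ τ η).Finite := fun ξ η hne => by
    rw [← Set.image_inter hginj]; exact (hT2 ξ η hne).image _
  have hp := hpa a h1
  let x : (ℕ → Bool) → B := fun ξ => h (pa a ⁻¹' τ ξ)
  have hxx : ∀ ξ η, x ξ ⊓ x η = h (pa a ⁻¹' (τ ξ ∩ τ η)) := fun ξ η => by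
    rw [Set.preimage_inter, H.hinf]
  have horth : ∀ n ∈ σ, ∀ ξ η, ξ ≠ η → b n ⊓ (x ξ ⊓ x η) = ⊥ := fun n hn ξ η hne => by
    rw [hxx]; exact H.fin_orth hp _ (h4 n hn) _ (hτf ξ η hne)
  obtain ⟨ξ, hξ⟩ := step_core Z1 hZ1c hg1 x
    (fun ξ η hne => by rw [hxx]; exact H.fin_mem hp _ ham _ (hτf ξ η hne))
    (fun ξ => {prom b σ (τ ξ)}) (by
      intro u v
      by_contra hunc
      set S := {ξ | ∃ p ∈ ({prom b σ (τ ξ)} : Set (Set B × Set B)), SepBy p (mix u v (x ξ))} with hS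
      have hSs : ∀ ξ ∈ S, SepBy (prom b σ (τ ξ)) (mix u v (x ξ)) := by
        rintro ξ ⟨p, rfl, hp⟩; exact hp
      have hcov : ∀ ξ ∈ S, ∀ η ∈ S, ∀ n ∈ τ ξ, n ∉ τ η → b n ≤ x ξ ⊔ x η := by
        intro ξ hξ η hη n hn hn'
        exact le_sup_of_mix ((hSs ξ hξ).1 _ ⟨n, hn, rfl⟩)
          ((hSs η hη).2 _ ⟨n, ⟨hτσ ξ hn, hn'⟩, rfl⟩)
      have hSinf : S.Infinite := fun hf => hunc hf.countable
      have hex : ∀ ξ, ∃ n, ξ ∈ S → n ∈ τ ξ ∧ b n ≤ x ξ := by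
        intro ξ
        by_cases hξ : ξ ∈ S
        swap
        · exact ⟨0, fun h => absurd h hξ⟩
        obtain ⟨η, hη, hη'⟩ := hSinf.exists_notMem_finite (Set.finite_singleton ξ)
        obtain ⟨ζ, hζ, hζ'⟩ := hSinf.exists_notMem_finite ((Set.finite_singleton ξ).insert η)
        have hne1 : ξ ≠ η := fun h => hη' h.symm
        have hne2 : ξ ≠ ζ := fun h => hζ' (Or.inr h.symm)
        have hne3 : η ≠ ζ := fun h => hζ' (Or.inl h.symm)
        obtain ⟨n, hn, hn'⟩ := (hτi ξ).exists_notMem_finite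
          ((hτf ξ η hne1).union (hτf ξ ζ hne2))
        refine ⟨n, fun _ => ⟨hn, ?_⟩⟩
        have c1 := hcov ξ hξ η hη n hn (fun h => hn' (Or.inl ⟨hn, h⟩))
        have c2 := hcov ξ hξ ζ hζ n hn (fun h => hn' (Or.inr ⟨hn, h⟩))
        have c3 : b n ≤ x ξ ⊔ (x η ⊓ x ζ) := by rw [sup_inf_left]; exact le_inf c1 c2
        have c4 := horth n (hτσ ξ hn) η ζ hne3
        calc b n = b n ⊓ (x ξ ⊔ (x η ⊓ x ζ)) := (inf_eq_left.2 c3).symm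
          _ = b n ⊓ x ξ := by rw [inf_sup_left, c4, sup_bot_eq]
          _ ≤ x ξ := inf_le_right
      choose n hn using hex
      apply hunc
      refine Set.MapsTo.countable_of_injOn (f := n) (t := Set.univ) (fun _ _ => trivial) ?_
        (Set.to_countable _)
      intro ξ hξ η hη he
      by_contra hne
      have d1 := hn ξ hξ
      have d2 := hn η hη
      rw [← he] at d2
      have := horth _ (hτσ ξ d1.1) ξ η hne
      rw [inf_eq_left.2 (le_inf d1.2 d2.2)] at this
      exact h3 _ (hτσ ξ d1.1) this)
  refine ⟨Sum.inl '' Set.range a ∪ insert (Sum.inl (x ξ)) (Sum.inr '' {prom b σ (τ ξ)}),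
    hcr.union (((Set.countable_singleton _).image _).insert _), ?_, ?_⟩
  · rw [← Set.union_assoc]; exact hξ
  · intro _ _ _ _
    right
    exact ⟨τ ξ, hτσ ξ, Or.inr (Or.inr (Or.inl rfl)),
      Or.inr (Or.inr (Or.inr ⟨_, rfl, rfl⟩))⟩

theorem stepTwo {B : Type} [BooleanAlgebra B] {h : Set ℕ → B} (H : PFH h)
    (pa : (ℕ → B) → ℕ → ℕ) (d : ℕ → B) (Z : Set (B ⊕ (Set B × Set B)))
    (hZ : #↥Z < continuum) (hg : GoodZ Z) :
    ∃ Y : Set (B ⊕ (Set B × Set B)), Y.Countable ∧ GoodZ (Z ∪ Y) ∧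
      DoneT h pa (Sum.inr d) (Z ∪ Y) := by
  by_cases hv : (∀ n, d n ≠ ⊥) ∧ Antitone d
  swap
  · exact ⟨∅, Set.countable_empty, by simpa using hg, fun h1 h2 => absurd ⟨h1, h2⟩ hv⟩
  obtain ⟨h1, h2⟩ := hv
  obtain ⟨T, hT1, hT2⟩ := exists_ad_family
  choose R hR using fun n => H.hsurj (d n)
  have hRR : ∀ n m, n ≤ m → (R m \ R n).Finite := fun n m hnm => by
    rw [← H.le_iff, hR, hR]; exact h2 hnm
  have hex : ∀ n N : ℕ, ∃ k, N < k ∧ ∀ i ≤ n, k ∈ R i := by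
    intro n N
    have hinf : (R n).Infinite := fun hf => h1 n (by rw [← hR, H.hker]; exact hf)
    have hfin : (Set.Iic N ∪ ⋃ i ∈ Set.Iic n, (R n \ R i)).Finite :=
      (Set.finite_Iic N).union ((Set.finite_Iic n).biUnion fun i hi => hRR i n hi)
    obtain ⟨k, hk, hk'⟩ := hinf.exists_notMem_finite hfin
    refine ⟨k, not_le.1 fun hle => hk' (Or.inl hle), fun i hi => ?_⟩
    by_contra hki
    apply hk'
    right
    simp only [Set.mem_iUnion]
    exact ⟨i, hi, hk, hki⟩
  choose f hf1 hf2 using hex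
  obtain ⟨g, hg0, hgs⟩ : ∃ g : ℕ → ℕ, g 0 = f 0 0 ∧ ∀ n, g (n+1) = f (n+1) (g n) :=
    ⟨fun n => Nat.rec (f 0 0) (fun n k => f (n+1) k) n, rfl, fun n => rfl⟩
  have hginj : Function.Injective g := by
    apply StrictMono.injective
    apply strictMono_nat_of_lt_succ
    intro n; rw [hgs]; exact hf1 _ _
  have hgR : ∀ n, ∀ i ≤ n, g n ∈ R i := by
    intro n
    cases n with
    | zero => rw [hg0]; exact hf2 _ _
    | succ n => rw [hgs]; exact hf2 _ _
  obtain ⟨ξ, hξ⟩ := step_core Z hZ hg (fun ξ => h (g '' T ξ))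
    (fun ξ η hne => by
      rw [← H.hinf, ← Set.image_inter hginj, (H.hker _).2 ((hT2 ξ η hne).image _)]
      exact BooleanSubalgebra.bot_mem)
    (fun _ => ∅) (by intro u v; simp)
  refine ⟨_, ?_, hξ, ?_⟩
  · simp
  · intro _ _
    refine ⟨h (g '' T ξ), ?_, Or.inr (Or.inl rfl), fun n => ?_⟩
    · rw [Ne, H.hker]
      exact (hT1 ξ).image hginj.injOn
    · rw [← hR n, H.le_iff]
      apply ((Set.finite_Iio n).image g).subset
      rintro _ ⟨⟨k, _, rfl⟩, hk⟩
      exact ⟨k, not_le.1 fun hle => hk (hgR k n hle), rfl⟩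

theorem build {B : Type} [BooleanAlgebra B] {h : Set ℕ → B} (H : PFH h) :
    ∃ (pa : (ℕ → B) → ℕ → ℕ) (Z : Set (B ⊕ (Set B × Set B))),
      (∀ a : ℕ → B, (∀ n m, n ≠ m → a n ⊓ a m = ⊥) → ∀ n, h (pa a ⁻¹' {n}) = a n) ∧
      GoodZ Z ∧ (∀ t, DoneT h pa t Z) ∧ (gens Z).Infinite := by
  have hpa0 : ∀ a : ℕ → B, ∃ p : ℕ → ℕ, (∀ n m, n ≠ m → a n ⊓ a m = ⊥) →
      ∀ n, h (p ⁻¹' {n}) = a n := fun a => by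
    by_cases ha : ∀ n m, n ≠ m → a n ⊓ a m = ⊥
    · obtain ⟨p, hp⟩ := H.exists_part a ha
      exact ⟨p, fun _ => hp⟩
    · exact ⟨id, fun h => absurd h ha⟩
  choose pa hpa using hpa0
  have hB : #B ≤ continuum := by
    have := mk_le_of_surjective H.hsurj
    simpa using this
  have hNB : #(ℕ → B) ≤ continuum := by
    have : #(ℕ → B) = #B ^ ℵ₀ := by simp
    rw [this, ← continuum_power_aleph0]
    exact power_le_power_right hB
  have hT : #(((ℕ → B) × Set ℕ × (ℕ → B)) ⊕ (ℕ → B)) ≤ continuum := by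
    rw [mk_sum, lift_id, lift_id]
    refine add_le_of_le aleph0_le_continuum ?_ hNB
    rw [mk_prod, lift_id, lift_id]
    refine mul_le_of_le aleph0_le_continuum hNB ?_
    rw [mk_prod, lift_id, lift_id]
    exact mul_le_of_le aleph0_le_continuum (by simp) hNB
  let S : ℕ → Set ℕ := fun n => {k | k.unpair.1 = n}
  have hSi : ∀ n, (S n).Infinite := fun n => by
    refine Set.infinite_of_injective_forall_mem (f := fun m => Nat.pair n m) ?_ ?_
    · intro m m' hm
      simpa using hm
    · intro m
      change (Nat.unpair (Nat.pair n m)).1 = n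
      simp
  have hSinj : Function.Injective fun n => h (S n) := by
    intro n m hnm
    by_contra hne
    have h1 : S n ∩ S m = ∅ := by
      ext k
      constructor
      · rintro ⟨e1, e2⟩; exact hne (Eq.trans (Eq.symm e1) e2)
      · intro hk; exact absurd hk (Set.notMem_empty k)
    have h2 : h (S n) = ⊥ := by
      calc h (S n) = h (S n) ⊓ h (S m) := by
            have : h (S n) = h (S m) := hnm
            rw [← this, inf_idem]
        _ = ⊥ := by rw [← H.hinf, h1, H.hbot]
    exact hSi n ((H.hker _).1 h2)
  obtain ⟨Z, hZ0, hZ, hd⟩ := transfinite_build hT GoodZ (DoneT h pa) GoodZ.fin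
    (DoneT.mono h pa) (Sum.inl '' Set.range fun n => h (S n))
    (by rintro p ⟨_, _, h⟩; cases h) ((Set.countable_range _).image _)
    (by
      rintro (⟨a, σ, b⟩ | d) Z hc hg
      · exact stepOne H pa hpa a σ b Z hc hg
      · exact stepTwo H pa d Z hc hg)
  refine ⟨pa, Z, hpa, hZ, hd, ?_⟩
  refine Set.infinite_of_injective_forall_mem hSinj fun n => hZ0 ⟨_, ⟨n, rfl⟩, rfl⟩

end PartTwo

section PartThree

theorem stone_compl {A : Type*} [BooleanAlgebra A] (y : StoneSpace A) (a : A) :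
    y.1 aᶜ = !(y.1 a) := by
  obtain ⟨h1, h2, h3, h4⟩ := y.2
  have e1 := h3 a aᶜ
  have e2 := h4 a aᶜ
  rw [sup_compl_eq_top, h1] at e1
  rw [inf_compl_eq_bot, h2] at e2
  revert e1 e2
  generalize y.1 a = p
  generalize y.1 aᶜ = q
  revert p q
  decide

theorem stone_inf {A ι : Type*} [BooleanAlgebra A] (y : StoneSpace A) (I : Finset ι) (f : ι → A) :
    y.1 (I.inf f) = true ↔ ∀ i ∈ I, y.1 (f i) = true := by
  classical
  obtain ⟨h1, h2, h3, h4⟩ := y.2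
  induction I using Finset.induction_on with
  | empty => simp [h1]
  | insert i I hi ih => rw [Finset.inf_insert, h4]; simp [ih]

theorem stone_le {A : Type*} [BooleanAlgebra A] (y : StoneSpace A) {a b : A} (hab : a ≤ b)
    (ha : y.1 a = true) : y.1 b = true := by
  have := y.2.2.2.2 a b
  rw [inf_eq_left.2 hab, ha] at this
  simpa using this.symm

theorem stone_basis {A : Type*} [BooleanAlgebra A] (U : Set (StoneSpace A)) (hU : IsOpen U)
    (x : StoneSpace A) (hx : x ∈ U) :
    ∃ a, x.1 a = true ∧ ∀ y : StoneSpace A, y.1 a = true → y ∈ U := by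
  classical
  obtain ⟨V, hV, rfl⟩ := isOpen_induced_iff.1 hU
  obtain ⟨I, u, hu, hs⟩ := isOpen_pi_iff.1 hV x.1 hx
  refine ⟨I.inf fun i => if x.1 i = true then i else iᶜ, ?_, ?_⟩
  · rw [stone_inf]
    intro i _
    split_ifs with h
    · exact h
    · rw [stone_compl]; simpa using h
  · intro y hy
    rw [stone_inf] at hy
    apply hs
    intro i hi
    have h1 := hy i hi
    have : y.1 i = x.1 i := by
      split_ifs at h1 with h
      · rw [h1, h]
      · rw [stone_compl] at h1
        simp at h h1
        rw [h1, h]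
    rw [this]
    exact (hu i hi).2

theorem stone_point {A : Type*} [BooleanAlgebra A] (w : A) (hw : w ≠ ⊥) :
    ∃ y : StoneSpace A, y.1 w = true := by
  classical
  obtain ⟨J, hJ, _, hd⟩ := DistribLattice.prime_ideal_of_disjoint_filter_ideal
    (F := Order.PFilter.principal w) (I := Order.Ideal.principal (⊥ : A)) (by
      rw [Set.disjoint_left]
      intro z hz hz'
      have e1 : w ≤ z := hz
      have e2 : z ≤ ⊥ := hz'
      exact hw (le_bot_iff.1 (e1.trans e2)))
  have hwJ : w ∉ J := fun h => Set.disjoint_left.1 hd (show w ∈ Order.PFilter.principal w from le_refl w) h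
  have htop : (⊤ : A) ∉ J := fun h => hwJ (J.lower le_top h)
  refine ⟨⟨fun a => decide (a ∉ J), ?_, ?_, ?_, ?_⟩, ?_⟩
  · simpa using htop
  · simp
  · intro a b
    by_cases ha : a ∈ J <;> by_cases hb : b ∈ J <;> simp [ha, hb]
  · intro a b
    have : a ⊓ b ∈ J ↔ a ∈ J ∨ b ∈ J := by
      constructor
      · exact fun h => hJ.mem_or_mem h
      · rintro (h | h)
        · exact J.lower inf_le_left h
        · exact J.lower inf_le_right h
    by_cases ha : a ∈ J <;> by_cases hb : b ∈ J <;> simp [ha, hb, this]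
  · simpa using hwJ

theorem stone_almostP {A : Type*} [BooleanAlgebra A]
    (hA : ∀ d : ℕ → A, (∀ n, d n ≠ ⊥) → Antitone d → ∃ w, w ≠ ⊥ ∧ ∀ n, w ≤ d n)
    (G : Set (StoneSpace A)) (hG : IsGδ G) (hne : G.Nonempty) : (interior G).Nonempty := by
  obtain ⟨U, hU, rfl⟩ := isGδ_iff_eq_iInter_nat.1 hG
  obtain ⟨x, hx⟩ := hne
  choose a ha1 ha2 using fun n => stone_basis (U n) (hU n) x (Set.mem_iInter.1 hx n)
  obtain ⟨w, hw, hwd⟩ := hA (fun n => (Finset.range (n+1)).inf a) (by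
    intro n hn
    have : x.1 ((Finset.range (n+1)).inf a) = true := by
      rw [stone_inf]; exact fun i _ => ha1 i
    rw [hn, x.2.2.1] at this
    cases this) (by
    intro n m hnm
    exact Finset.inf_mono (Finset.range_mono (Nat.succ_le_succ hnm)))
  obtain ⟨y, hy⟩ := stone_point w hw
  refine ⟨y, mem_interior.2 ⟨{z | z.1 w = true}, ?_, ?_, hy⟩⟩
  · intro z hz
    refine Set.mem_iInter.2 fun n => ha2 n z (stone_le z ((hwd n).trans ?_) hz)
    exact Finset.inf_le (Finset.self_mem_range_succ n)
  · have hc : Continuous fun z : StoneSpace A => z.1 w :=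
      (continuous_apply w).comp continuous_subtype_val
    exact (isOpen_discrete {true}).preimage hc

theorem main_type0
    (B : Type) [BooleanAlgebra B] (h : Set ℕ → B) (H : PFH h) :
    ∃ (A : Type) (_ : BooleanAlgebra A) (e : A → B),
      Infinite A ∧ Function.Injective e ∧
      e ⊥ = ⊥ ∧ e ⊤ = ⊤ ∧ (∀ x y : A, e (x ⊔ y) = e x ⊔ e y) ∧
      (∀ x y : A, e (x ⊓ y) = e x ⊓ e y) ∧ (∀ x : A, e xᶜ = (e x)ᶜ) ∧
      (∀ G : Set (StoneSpace A), IsGδ G → G.Nonempty → (interior G).Nonempty) ∧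
      (∀ a : ℕ → A, (∀ n, a n ≠ ⊥) → (∀ n m, n ≠ m → a n ⊓ a m = ⊥) →
        ∃ (P : Set (Set ℕ)) (φ : Set ℕ → A),
          (∀ s : Set ℕ, s.Finite → s ∈ P) ∧ (Set.univ ∈ P) ∧
          (∀ s ∈ P, sᶜ ∈ P) ∧ (∀ s ∈ P, ∀ t ∈ P, s ∪ t ∈ P) ∧
          (∀ s ∈ P, ∀ t ∈ P, s ∩ t ∈ P) ∧
          (φ ∅ = ⊥) ∧ (∀ s ∈ P, ∀ t ∈ P, φ (s ∩ t) = φ s ⊓ φ t) ∧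
          (∀ s ∈ P, ∀ t ∈ P, φ (s ∪ t) = φ s ⊔ φ t) ∧
          (∀ n : ℕ, φ {n} = a n) ∧
          (∀ σ : Set ℕ, σ.Infinite →
            ∀ b : ℕ → A, (∀ n ∈ σ, b n ≠ ⊥) →
              (∀ n ∈ σ, ∀ m ∈ σ, n ≠ m → b n ⊓ b m = ⊥) →
              (∀ n ∈ σ, ∀ m : ℕ, b n ⊓ a m = ⊥) →
              ∃ τ ⊆ σ, τ ∈ P ∧
                ¬ BASeparated {x | ∃ n ∈ τ, x = b n} {x | ∃ n ∈ σ \ τ, x = b n})) := by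
  classical
  obtain ⟨pa, Z, hpa, hZ, hd, hinf⟩ := build H
  let L := BooleanSubalgebra.closure (gens Z)
  refine ⟨L, inferInstance, Subtype.val, ?_, Subtype.val_injective, rfl, rfl, fun _ _ => rfl,
    fun _ _ => rfl, fun _ => rfl, ?_, ?_⟩
  · have : (L : Set B).Infinite := hinf.mono BooleanSubalgebra.subset_closure
    exact this.to_subtype
  · apply stone_almostP
    intro d h1 h2
    obtain ⟨w, hw1, hw2, hw3⟩ := hd (Sum.inr fun n => (d n : B))
      (fun n hn => h1 n (Subtype.ext hn)) (fun n m hnm => h2 hnm)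
    refine ⟨⟨w, BooleanSubalgebra.subset_closure hw2⟩, ?_, fun n => hw3 n⟩
    intro h0
    exact hw1 (congrArg Subtype.val h0)
  · intro a _ ha
    have ha' : ∀ n m, n ≠ m → (a n : B) ⊓ a m = ⊥ := fun n m hnm =>
      congrArg Subtype.val (ha n m hnm)
    set p := pa (fun n => (a n : B)) with hpdef
    have hp : ∀ n, h (p ⁻¹' {n}) = a n := hpa _ ha'
    let φ : Set ℕ → L := fun τ => if hτ : h (p ⁻¹' τ) ∈ L then ⟨_, hτ⟩ else ⊥
    have hφ : ∀ τ, h (p ⁻¹' τ) ∈ L → (φ τ : B) = h (p ⁻¹' τ) := fun τ hτ => by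
      simp only [φ, dif_pos hτ]
    have hfin : ∀ s : Set ℕ, s.Finite → h (p ⁻¹' s) ∈ L := fun s hs =>
      H.fin_mem hp L (fun n => (a n).2) s hs
    have hU : ∀ s, h (p ⁻¹' s) ∈ L → ∀ t, h (p ⁻¹' t) ∈ L → h (p ⁻¹' (s ∪ t)) ∈ L := by
      intro s hs t ht
      rw [Set.preimage_union, H.hsup]; exact BooleanSubalgebra.sup_mem hs ht
    have hI : ∀ s, h (p ⁻¹' s) ∈ L → ∀ t, h (p ⁻¹' t) ∈ L → h (p ⁻¹' (s ∩ t)) ∈ L := by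
      intro s hs t ht
      rw [Set.preimage_inter, H.hinf]; exact BooleanSubalgebra.inf_mem hs ht
    refine ⟨{τ | h (p ⁻¹' τ) ∈ L}, φ, hfin, ?_, ?_, hU, hI, ?_, ?_, ?_, ?_, ?_⟩
    · change h (p ⁻¹' Set.univ) ∈ L
      rw [Set.preimage_univ, H.htop]; exact BooleanSubalgebra.top_mem
    · intro s hs
      change h (p ⁻¹' sᶜ) ∈ L
      rw [Set.preimage_compl, H.hcompl]; exact BooleanSubalgebra.compl_mem hs
    · apply Subtype.ext
      rw [hφ _ (hfin _ Set.finite_empty), Set.preimage_empty, H.hbot]; rfl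
    · intro s hs t ht
      apply Subtype.ext
      rw [hφ _ (hI s hs t ht), Set.preimage_inter, H.hinf, ← hφ s hs, ← hφ t ht]; rfl
    · intro s hs t ht
      apply Subtype.ext
      rw [hφ _ (hU s hs t ht), Set.preimage_union, H.hsup, ← hφ s hs, ← hφ t ht]; rfl
    · intro n
      apply Subtype.ext
      rw [hφ _ (hfin _ (Set.finite_singleton n)), hp]
    · intro σ hσ b hb1 _ hb3
      rcases hd (Sum.inl (fun n => (a n : B), σ, fun n => (b n : B))) ha' hσ
        (fun n hn h0 => hb1 n hn (Subtype.ext h0))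
        (fun n hn m => congrArg Subtype.val (hb3 n hn m)) with hbad | ⟨τ, hτσ, hτ1, hτ2⟩
      · exfalso
        apply hbad
        intro q hq c hc
        have hq : Sum.inr q ∈ Z := by
          rcases hq with hq | ⟨_, _, hq⟩
          · exact hq
          · cases hq
        refine hZ q hq c ?_
        refine (BooleanSubalgebra.closure_le (L := L)).2 ?_ hc
        rintro z (hz | ⟨_, ⟨n, rfl⟩, hz⟩)
        · exact BooleanSubalgebra.subset_closure hz
        · rw [← Sum.inl_injective hz]; exact (a n).2
      · refine ⟨τ, hτσ, BooleanSubalgebra.subset_closure hτ1, ?_⟩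
        rintro ⟨c, hc1, hc2⟩
        refine hZ _ hτ2 c.1 c.2 ⟨?_, ?_⟩
        · rintro _ ⟨n, hn, rfl⟩
          exact hc1 _ ⟨n, hn, rfl⟩
        · rintro _ ⟨n, hn, rfl⟩
          exact congrArg Subtype.val (hc2 _ ⟨n, hn, rfl⟩)

end PartThree

/-- There exists an infinite Boolean subalgebra `A` of `B = P(ℕ)/Fin` (here `B` is any
Boolean algebra presented as the quotient of `P(ℕ)` by the ideal of finite sets, via a
surjective Boolean homomorphism `h` whose kernel is the finite sets, and the subalgebra is
presented as a Boolean algebra `A` with an injective Boolean homomorphism `e : A → B`)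
such that: (i) the Stone space of `A` is an almost P-space, and (ii) for every pairwise
disjoint sequence `a : ℕ → A \ {⊥}` there are a subalgebra `P_a ⊆ P(ℕ)` containing all
finite sets and a submorphism `φ_a : P_a → A` with `φ_a {n} = a n`, such that for every
infinite `σ ⊆ ℕ` and every pairwise disjoint family `{b n : n ∈ σ} ⊆ A \ {⊥}` orthogonal to
`{a n : n ∈ ℕ}` there is `τ ⊆ σ`, `τ ∈ P_a`, with `{b n : n ∈ τ}` and `{b n : n ∈ σ \ τ}`
not separated in `A`. -/
theorem exists_subalgebra_of_PNat_mod_fin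
    (B : Type*) [BooleanAlgebra B] (h : Set ℕ → B)
    (hbot : h ∅ = ⊥) (htop : h Set.univ = ⊤)
    (hsup : ∀ s t : Set ℕ, h (s ∪ t) = h s ⊔ h t)
    (hinf : ∀ s t : Set ℕ, h (s ∩ t) = h s ⊓ h t)
    (hcompl : ∀ s : Set ℕ, h sᶜ = (h s)ᶜ)
    (hsurj : Function.Surjective h)
    (hker : ∀ s : Set ℕ, h s = ⊥ ↔ s.Finite) :
    ∃ (A : Type) (_ : BooleanAlgebra A) (e : A → B),
      -- `A` is an infinite subalgebra of `B`
      Infinite A ∧ Function.Injective e ∧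
      e ⊥ = ⊥ ∧ e ⊤ = ⊤ ∧ (∀ x y : A, e (x ⊔ y) = e x ⊔ e y) ∧
      (∀ x y : A, e (x ⊓ y) = e x ⊓ e y) ∧ (∀ x : A, e xᶜ = (e x)ᶜ) ∧
      -- (i) the Stone space of `A` is an almost P-space
      (∀ G : Set (StoneSpace A), IsGδ G → G.Nonempty → (interior G).Nonempty) ∧
      -- (ii)
      (∀ a : ℕ → A, (∀ n, a n ≠ ⊥) → (∀ n m, n ≠ m → a n ⊓ a m = ⊥) →
        ∃ (P : Set (Set ℕ)) (φ : Set ℕ → A),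
          (∀ s : Set ℕ, s.Finite → s ∈ P) ∧ (Set.univ ∈ P) ∧
          (∀ s ∈ P, sᶜ ∈ P) ∧ (∀ s ∈ P, ∀ t ∈ P, s ∪ t ∈ P) ∧
          (∀ s ∈ P, ∀ t ∈ P, s ∩ t ∈ P) ∧
          (φ ∅ = ⊥) ∧ (∀ s ∈ P, ∀ t ∈ P, φ (s ∩ t) = φ s ⊓ φ t) ∧
          (∀ s ∈ P, ∀ t ∈ P, φ (s ∪ t) = φ s ⊔ φ t) ∧
          (∀ n : ℕ, φ {n} = a n) ∧
          (∀ σ : Set ℕ, σ.Infinite →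
            ∀ b : ℕ → A, (∀ n ∈ σ, b n ≠ ⊥) →
              (∀ n ∈ σ, ∀ m ∈ σ, n ≠ m → b n ⊓ b m = ⊥) →
              (∀ n ∈ σ, ∀ m : ℕ, b n ⊓ a m = ⊥) →
              ∃ τ ⊆ σ, τ ∈ P ∧
                ¬ BASeparated {x | ∃ n ∈ τ, x = b n} {x | ∃ n ∈ σ \ τ, x = b n})) := by
  have hsm : Small.{0} B := small_of_surjective hsurj
  let i : Shrink.{0} B ≃ B := (equivShrink B).symm
  letI : BooleanAlgebra (Shrink.{0} B) := i.booleanAlgebra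
  have isup : ∀ x y, i (x ⊔ y) = i x ⊔ i y := fun x y => i.apply_symm_apply _
  have iinf : ∀ x y, i (x ⊓ y) = i x ⊓ i y := fun x y => i.apply_symm_apply _
  have icompl : ∀ x, i xᶜ = (i x)ᶜ := fun x => i.apply_symm_apply _
  have ibot : i ⊥ = ⊥ := i.apply_symm_apply _
  have itop : i ⊤ = ⊤ := i.apply_symm_apply _
  have H : PFH (fun s => i.symm (h s)) :=
    { hbot := by rw [Equiv.symm_apply_eq, ibot, hbot]
      htop := by rw [Equiv.symm_apply_eq, itop, htop]
      hsup := fun s t => by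
        rw [Equiv.symm_apply_eq, isup, hsup]; simp
      hinf := fun s t => by
        rw [Equiv.symm_apply_eq, iinf, hinf]; simp
      hcompl := fun s => by
        rw [Equiv.symm_apply_eq, icompl, hcompl]; simp
      hsurj := i.symm.surjective.comp hsurj
      hker := fun s => by
        rw [Equiv.symm_apply_eq, ibot, hker] }
  obtain ⟨A, iA, e, h1, h2, h3, h4, h5, h6, h7, h8, h9⟩ := main_type0 _ _ H
  exact ⟨A, iA, fun x => i (e x), h1, i.injective.comp h2,
    (congrArg i h3).trans ibot, (congrArg i h4).trans itop,
    fun x y => (congrArg i (h5 x y)).trans (isup _ _),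
    fun x y => (congrArg i (h6 x y)).trans (iinf _ _),
    fun x => (congrArg i (h7 x)).trans (icompl _), h8, h9⟩
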